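/- A hypersemigroup (H, ∘) is regular if and only if for every right ideal X of H, every left ideal Y of H, and every bi-ideal B of H, X ∩ B ∩ Y ⊆ (X*B)*Y. -/

import Mathlib

/-- The product of subsets of a hypergroupoid: `A*B := ⋃_{(a,b) ∈ A×B} a∘b`. -/
def hProd {H : Type*} (circ : H → H → Set H) (A B : Set H) : Set H :=
  ⋃ a ∈ A, ⋃ b ∈ B, circ a b

theorem mem_hProd {H : Type*} {circ : H → H → Set H} {A B : Set H} {t : H} :
    t ∈ hProd circ A B ↔ ∃ a ∈ A, ∃ b ∈ B, t ∈ circ a b := by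
  simp [hProd]

theorem exists_mem_circ_comm {H : Type*} {circ : H → H → Set H}
    (assoc : ∀ x y z : H, hProd circ {x} (circ y z) = hProd circ (circ x y) {z}) (x y z t : H) :
    (∃ v ∈ circ y z, t ∈ circ x v) ↔ ∃ u ∈ circ x y, t ∈ circ u z := by
  simpa [mem_hProd] using Set.ext_iff.mp (assoc x y z) t

/-- Proposition 19: a hypersemigroup is regular iff `X ∩ B ∩ Y ⊆ (X*B)*Y` for every
right ideal `X`, every left ideal `Y` and every bi-ideal `B`. -/
theorem regular_iff_biIdeal {H : Type*} [Nonempty H] (circ : H → H → Set H)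
    (hcirc : ∀ a b : H, (circ a b).Nonempty)
    (assoc : ∀ x y z : H, hProd circ {x} (circ y z) = hProd circ (circ x y) {z}) :
    (∀ a : H, ∃ x : H, a ∈ hProd circ (circ a x) {a}) ↔
      (∀ X Y B : Set H, X.Nonempty → Y.Nonempty → B.Nonempty →
        hProd circ X Set.univ ⊆ X → hProd circ Set.univ Y ⊆ Y →
        hProd circ (hProd circ B Set.univ) B ⊆ B →
        X ∩ B ∩ Y ⊆ hProd circ (hProd circ X B) Y) := by
  have assoc' := exists_mem_circ_comm assoc
  constructor
  · rintro hreg X Y B - - - hX hY - a ⟨⟨haX, haB⟩, haY⟩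
    obtain ⟨x, hx⟩ := hreg a
    obtain ⟨p, hp, _, rfl, hap⟩ := mem_hProd.mp hx
    obtain ⟨v, hv, hav⟩ := (assoc' _ _ _ _).mpr ⟨p, hp, hap⟩
    have hpX : p ∈ X := hX (mem_hProd.mpr ⟨_, haX, x, trivial, hp⟩)
    have hvY : v ∈ Y := hY (mem_hProd.mpr ⟨x, trivial, _, haY, hv⟩)
    exact mem_hProd.mpr ⟨_, mem_hProd.mpr ⟨p, hpX, _, haB, hap⟩, v, hvY, hav⟩
  · intro h a
    have right_mul {u w k : H} (hw : ∃ m, w ∈ circ a m) (hu : u ∈ circ w k) :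
        ∃ m, u ∈ circ a m := by
      obtain ⟨m, hm⟩ := hw
      obtain ⟨v, -, hv⟩ := (assoc' _ _ _ _).mpr ⟨w, hm, hu⟩
      exact ⟨v, hv⟩
    have left_mul {u w k : H} (hw : ∃ m, w ∈ circ m a) (hu : u ∈ circ k w) :
        ∃ m, u ∈ circ m a := by
      obtain ⟨m, hm⟩ := hw
      obtain ⟨v, -, hv⟩ := (assoc' _ _ _ _).mp ⟨w, hm, hu⟩
      exact ⟨v, hv⟩
    have key := h {t | t = a ∨ ∃ m, t ∈ circ a m} {t | t = a ∨ ∃ m, t ∈ circ m a} Set.univ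
      ⟨a, Or.inl rfl⟩ ⟨a, Or.inl rfl⟩ ⟨a, trivial⟩
      (by
        intro t ht
        obtain ⟨w, rfl | hw, k, -, htk⟩ := mem_hProd.mp ht
        · exact Or.inr ⟨k, htk⟩
        · exact Or.inr (right_mul hw htk))
      (by
        intro t ht
        obtain ⟨k, -, w, rfl | hw, htk⟩ := mem_hProd.mp ht
        · exact Or.inr ⟨k, htk⟩
        · exact Or.inr (left_mul hw htk))
      (Set.subset_univ _) ⟨⟨Or.inl rfl, trivial⟩, Or.inl rfl⟩
    obtain ⟨w, hw, y, hy, hay⟩ := mem_hProd.mp key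
    obtain ⟨x, hx, b, -, hwb⟩ := mem_hProd.mp hw
    have hwa : ∃ m, w ∈ circ a m := by
      rcases hx with rfl | hx
      · exact ⟨b, hwb⟩
      · exact right_mul hx hwb
    have hu : ∃ u, (∃ m, u ∈ circ a m) ∧ a ∈ circ u a := by
      rcases hy with rfl | ⟨k, hk⟩
      · exact ⟨w, hwa, hay⟩
      · obtain ⟨u, hu, hau⟩ := (assoc' _ _ _ _).mp ⟨y, hk, hay⟩
        exact ⟨u, right_mul hwa hu, hau⟩
    obtain ⟨u, ⟨m, hm⟩, hau⟩ := hu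
    exact ⟨m, mem_hProd.mpr ⟨u, hm, a, rfl, hau⟩⟩
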